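/- arXiv:1704.05314 — 3 statements merged into one kernel-verified Lean document; each statement's English description precedes it below -/
import Mathlib

section
/- Let n ≥ 1, x₀ ∈ ℝⁿ, 0 < ε < ϱ, 0 < ℏ, T > 0, and let p : [0,T] → ℝ be continuous with 0 < p(t) ≤ p₂. Let Ψ : ℝⁿ → ℝ be C^∞ with compact support contained in the open ball B(x₀,ϱ), with Ψ = 1 on B(x₀, ϱ − ε) and 0 ≤ Ψ ≤ 1. Let v : ℝⁿ × [0,T] → ℝ be smooth, with v(·,t) a Schwartz function for each t, satisfying ∂ₜv(x,t) = p(t) Δv(x,t). Then for every t ∈ (0,T): d/dt ∫_{ℝⁿ} |Ψ(x) v(x,t)|² e^{−|x−x₀|²/ℏ} dx ≤ (4 p₂ ϱ²/ℏ²) ∫_{ℝⁿ} |Ψ(x) v(x,t)|² e^{−|x−x₀|²/ℏ} dx + 4 p₂ ‖∇Ψ‖_∞² e^{−(ϱ−ε)²/ℏ} ∫_{ℝⁿ} |v(x,t)|² dx. -/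
open MeasureTheory

/-- The Laplacian of `f : ℝⁿ → ℝ` at `x`, as the trace of the second derivative. -/
noncomputable def lapl {n : ℕ} (f : EuclideanSpace ℝ (Fin n) → ℝ)
    (x : EuclideanSpace ℝ (Fin n)) : ℝ :=
  ∑ i : Fin n, iteratedFDeriv ℝ 2 f x ![EuclideanSpace.single i 1, EuclideanSpace.single i 1]

theorem lapl_eq_sum_fderiv {n : ℕ} {f : EuclideanSpace ℝ (Fin n) → ℝ} (hf : ContDiff ℝ 2 f)
    (x : EuclideanSpace ℝ (Fin n)) :
    lapl f x = ∑ i, fderiv ℝ (fun y => fderiv ℝ f y (EuclideanSpace.single i 1)) x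
      (EuclideanSpace.single i 1) := by
  have hd : Differentiable ℝ (fderiv ℝ f) :=
    (hf.fderiv_right (m := 1) (by norm_num)).differentiable (by norm_num)
  unfold lapl
  refine Finset.sum_congr rfl fun i _ => ?_
  rw [iteratedFDeriv_two_apply, fderiv_clm_apply (hd x) (differentiableAt_const _)]
  simp

/-- Integration by parts against the Laplacian, for a compactly supported factor. -/
theorem integral_mul_lapl {n : ℕ} {g f : EuclideanSpace ℝ (Fin n) → ℝ} (hg : ContDiff ℝ 1 g)
    (hgc : HasCompactSupport g) (hf : ContDiff ℝ 2 f) :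
    ∫ x, g x * lapl f x = ∫ x, -∑ i, fderiv ℝ g x (EuclideanSpace.single i 1) *
      fderiv ℝ f x (EuclideanSpace.single i 1) := by
  have hf' (i : Fin n) : ContDiff ℝ 1 (fun y => fderiv ℝ f y (EuclideanSpace.single i 1)) :=
    (hf.fderiv_right (m := 1) (by norm_num)).clm_apply contDiff_const
  have hf'' (i : Fin n) : Continuous fun x =>
      fderiv ℝ (fun y => fderiv ℝ f y (EuclideanSpace.single i 1)) x
        (EuclideanSpace.single i 1) :=
    ((hf' i).continuous_fderiv one_ne_zero).clm_apply continuous_const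
  have hg' (i : Fin n) : Continuous fun x => fderiv ℝ g x (EuclideanSpace.single i 1) :=
    (hg.continuous_fderiv one_ne_zero).clm_apply continuous_const
  have hint (i : Fin n) : Integrable fun x => g x *
      fderiv ℝ (fun y => fderiv ℝ f y (EuclideanSpace.single i 1)) x
        (EuclideanSpace.single i 1) :=
    (hg.continuous.mul (hf'' i)).integrable_of_hasCompactSupport hgc.mul_right
  have hint' (i : Fin n) : Integrable fun x => fderiv ℝ g x (EuclideanSpace.single i 1) *
      fderiv ℝ f x (EuclideanSpace.single i 1) :=
    ((hg' i).mul (hf' i).continuous).integrable_of_hasCompactSupport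
      (hgc.fderiv_apply ℝ _).mul_right
  simp_rw [lapl_eq_sum_fderiv hf, Finset.mul_sum, integral_neg]
  rw [integral_finsetSum _ fun i _ => hint i, integral_finsetSum _ fun i _ => hint' i,
    ← Finset.sum_neg_distrib]
  refine Finset.sum_congr rfl fun i _ => ?_
  exact integral_mul_fderiv_eq_neg_fderiv_mul_of_integrable (hint' i) (hint i)
    ((hg.continuous.mul (hf' i).continuous).integrable_of_hasCompactSupport hgc.mul_right)
    (fun x _ => hg.differentiable one_ne_zero x)
    (fun x _ => (hf' i).differentiable one_ne_zero x)

/-- Differentiation under the integral sign for a localized energy. -/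
theorem hasDerivAt_integral_mul_sq {n : ℕ} {θ : EuclideanSpace ℝ (Fin n) → ℝ}
    (hθ : Continuous θ) (hθc : HasCompactSupport θ) {v : EuclideanSpace ℝ (Fin n) → ℝ → ℝ}
    (hv : ContDiff ℝ 1 (fun q : EuclideanSpace ℝ (Fin n) × ℝ => v q.1 q.2)) (t : ℝ) :
    HasDerivAt (fun s => ∫ x, θ x * v x s ^ 2) (∫ x, θ x * (2 * v x t * deriv (v x) t)) t := by
  have hvx (x : EuclideanSpace ℝ (Fin n)) : ContDiff ℝ 1 (v x) :=
    hv.comp (contDiff_const.prodMk contDiff_id)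
  have hd (x : EuclideanSpace ℝ (Fin n)) (s : ℝ) : HasDerivAt (v x) (deriv (v x) s) s :=
    ((hvx x).differentiable one_ne_zero s).hasDerivAt
  have hderiv (x : EuclideanSpace ℝ (Fin n)) (s : ℝ) : deriv (v x) s =
      fderiv ℝ (fun q : EuclideanSpace ℝ (Fin n) × ℝ => v q.1 q.2) (x, s) (0, 1) :=
    (((hv.differentiable one_ne_zero (x, s)).hasFDerivAt).comp_hasDerivAt s
      ((hasDerivAt_const s x).prodMk (hasDerivAt_id s))).deriv
  have hdc : Continuous fun q : EuclideanSpace ℝ (Fin n) × ℝ => deriv (v q.1) q.2 := by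
    simp_rw [hderiv]
    exact (hv.continuous_fderiv one_ne_zero).clm_apply continuous_const
  have hF : Continuous fun q : EuclideanSpace ℝ (Fin n) × ℝ =>
      θ q.1 * (2 * v q.1 q.2 * deriv (v q.1) q.2) :=
    (hθ.comp continuous_fst).mul ((continuous_const.mul hv.continuous).mul hdc)
  have hvs (s : ℝ) : Continuous fun x => v x s := hv.continuous.comp (.prodMk_left s)
  have hFs (s : ℝ) : Continuous fun x => θ x * v x s ^ 2 := hθ.mul ((hvs s).pow 2)
  obtain ⟨C, hC⟩ := (hθc.isCompact.prod (isCompact_Icc (a := t - 1) (b := t + 1)))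
    |>.exists_bound_of_continuousOn hF.continuousOn
  refine (hasDerivAt_integral_of_dominated_loc_of_deriv_le
    (bound := (tsupport θ).indicator fun _ => C)
    (F' := fun s x => θ x * (2 * v x s * deriv (v x) s))
    (Icc_mem_nhds (sub_one_lt t) (lt_add_one t))
    (.of_forall fun s => (hFs s).aestronglyMeasurable)
    ((hFs t).integrable_of_hasCompactSupport hθc.mul_right)
    (hF.comp (.prodMk_left t)).aestronglyMeasurable (.of_forall fun x s hs => ?_) ?_
    (.of_forall fun x s _ => ?_)).2
  · by_cases hx : x ∈ tsupport θ
    · simpa [hx] using hC (x, s) ⟨hx, hs⟩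
    · simp [hx, image_eq_zero_of_notMem_tsupport hx]
  · exact (integrable_indicator_iff (isClosed_tsupport θ).measurableSet).2
      (integrableOn_const hθc.isCompact.measure_lt_top.ne)
  · simpa using ((hd x s).pow 2).const_mul (θ x)

theorem contDiff_gaussian {n : ℕ} (x₀ : EuclideanSpace ℝ (Fin n)) (ℏ : ℝ) :
    ContDiff ℝ 1 fun x => Real.exp (-‖x - x₀‖ ^ 2 / ℏ) :=
  (((contDiff_id.sub contDiff_const).norm_sq ℝ).neg.div_const ℏ).exp

theorem fderiv_gaussian_single {n : ℕ} (x₀ x : EuclideanSpace ℝ (Fin n)) (ℏ : ℝ) (i : Fin n) :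
    fderiv ℝ (fun x => Real.exp (-‖x - x₀‖ ^ 2 / ℏ)) x (EuclideanSpace.single i 1) =
      Real.exp (-‖x - x₀‖ ^ 2 / ℏ) * (-(2 * (x - x₀) i) / ℏ) := by
  have h : HasFDerivAt (fun x => Real.exp (-‖x - x₀‖ ^ 2 / ℏ)) _ x :=
    ((((hasFDerivAt_id x).sub_const x₀).norm_sq.neg.mul_const ℏ⁻¹).exp)
  rw [h.fderiv]
  simp [EuclideanSpace.inner_single_right, div_eq_mul_inv]
  ring

theorem norm_gradient_sq_eq_sum {n : ℕ} (f : EuclideanSpace ℝ (Fin n) → ℝ)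
    (x : EuclideanSpace ℝ (Fin n)) :
    ‖gradient f x‖ ^ 2 = ∑ i, fderiv ℝ f x (EuclideanSpace.single i 1) ^ 2 := by
  rw [EuclideanSpace.norm_sq_eq]
  refine Finset.sum_congr rfl fun i _ => ?_
  rw [← inner_gradient_left, EuclideanSpace.inner_single_right]
  simp

/-- Pointwise form of the energy estimate: the cross terms are absorbed by Young's inequality. -/
theorem neg_sum_fderiv_mul_fderiv_le {n : ℕ} {Ψ u : EuclideanSpace ℝ (Fin n) → ℝ}
    (hΨ : Differentiable ℝ Ψ) (hu : Differentiable ℝ u) (x₀ x : EuclideanSpace ℝ (Fin n))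
    (ℏ : ℝ) :
    -∑ i, fderiv ℝ (fun y => Ψ y ^ 2 * Real.exp (-‖y - x₀‖ ^ 2 / ℏ) * u y) x
        (EuclideanSpace.single i 1) * fderiv ℝ u x (EuclideanSpace.single i 1) ≤
      2 * (‖gradient Ψ x‖ ^ 2 * Real.exp (-‖x - x₀‖ ^ 2 / ℏ) * u x ^ 2 +
        ‖x - x₀‖ ^ 2 / ℏ ^ 2 * ((Ψ x * u x) ^ 2 * Real.exp (-‖x - x₀‖ ^ 2 / ℏ))) := by
  have hw := (contDiff_gaussian x₀ ℏ).differentiable one_ne_zero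
  rw [norm_gradient_sq_eq_sum, EuclideanSpace.norm_sq_eq (x - x₀), Finset.sum_div, Finset.sum_mul,
    Finset.sum_mul, Finset.sum_mul, ← Finset.sum_add_distrib, Finset.mul_sum,
    ← Finset.sum_neg_distrib, ← EuclideanSpace.norm_sq_eq (x - x₀)]
  refine Finset.sum_le_sum fun i _ => ?_
  have hfd : fderiv ℝ (fun y => Ψ y ^ 2 * Real.exp (-‖y - x₀‖ ^ 2 / ℏ) * u y) x
      (EuclideanSpace.single i 1) = Real.exp (-‖x - x₀‖ ^ 2 / ℏ) *
        ((2 * Ψ x * fderiv ℝ Ψ x (EuclideanSpace.single i 1) -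
          2 * Ψ x ^ 2 * ((x - x₀) i / ℏ)) * u x +
          Ψ x ^ 2 * fderiv ℝ u x (EuclideanSpace.single i 1)) := by
    have h : HasFDerivAt (fun y => Ψ y ^ 2 * Real.exp (-‖y - x₀‖ ^ 2 / ℏ) * u y) _ x :=
      (((hΨ x).hasFDerivAt.pow 2).mul (hw x).hasFDerivAt).mul (hu x).hasFDerivAt
    rw [h.fderiv]
    simp only [add_apply, smul_apply, smul_eq_mul, fderiv_gaussian_single, Pi.mul_apply]
    simp
    ring
  rw [hfd, Real.norm_eq_abs, sq_abs, ← div_pow]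
  set a := fderiv ℝ u x (EuclideanSpace.single i 1)
  set b := fderiv ℝ Ψ x (EuclideanSpace.single i 1)
  set y := (x - x₀) i / ℏ
  set w := Real.exp (-‖x - x₀‖ ^ 2 / ℏ)
  have hw0 : 0 ≤ w := (Real.exp_pos _).le
  have h1 : 0 ≤ w * (Ψ x * a + (u x * b - Ψ x * u x * y)) ^ 2 := by positivity
  have h2 : 0 ≤ w * (u x * b + Ψ x * u x * y) ^ 2 := by positivity
  linarith

/-- Whole-space version of the localized energy differential inequality of Lemma 3:
for a solution `v` of `∂ₜv = p(t)Δv` and a cut-off `Ψ` of the ball `B(x₀,ϱ)` equal to `1`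
on `B(x₀,ϱ−ε)`, the Gaussian-weighted localized energy satisfies
`d/dt ∫ |Ψv|²e^{−|x−x₀|²/ℏ} ≤ (4p₂ϱ²/ℏ²)∫|Ψv|²e^{−|x−x₀|²/ℏ}
  + 4p₂‖∇Ψ‖_∞² e^{−(ϱ−ε)²/ℏ} ∫ v²`. -/
theorem localized_energy_inequality
    (n : ℕ) (hn : 1 ≤ n) (x₀ : EuclideanSpace ℝ (Fin n))
    (ϱ ε ℏ T p₂ : ℝ) (hε : 0 < ε) (hεϱ : ε < ϱ) (hℏ : 0 < ℏ) (hT : 0 < T)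
    (p : ℝ → ℝ) (hp : ContinuousOn p (Set.Icc 0 T))
    (hpbd : ∀ t ∈ Set.Icc (0 : ℝ) T, 0 < p t ∧ p t ≤ p₂)
    (Ψ : EuclideanSpace ℝ (Fin n) → ℝ) (hΨ : ContDiff ℝ (⊤ : ℕ∞) Ψ)
    (hΨc : HasCompactSupport Ψ) (hΨsupp : tsupport Ψ ⊆ Metric.ball x₀ ϱ)
    (hΨ1 : ∀ x ∈ Metric.ball x₀ (ϱ - ε), Ψ x = 1)
    (hΨ01 : ∀ x, 0 ≤ Ψ x ∧ Ψ x ≤ 1)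
    (v : EuclideanSpace ℝ (Fin n) → ℝ → ℝ)
    (hv : ContDiff ℝ (⊤ : ℕ∞) (fun q : EuclideanSpace ℝ (Fin n) × ℝ => v q.1 q.2))
    (hvS : ∀ t : ℝ, ∃ V : SchwartzMap (EuclideanSpace ℝ (Fin n)) ℝ, ∀ x, V x = v x t)
    (hveq : ∀ x, ∀ t ∈ Set.Icc (0 : ℝ) T, deriv (v x) t = p t * lapl (fun y => v y t) x) :
    ∀ t ∈ Set.Ioo (0 : ℝ) T,
      deriv (fun s => ∫ x, (Ψ x * v x s) ^ 2 * Real.exp (-‖x - x₀‖ ^ 2 / ℏ)) t ≤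
        (4 * p₂ * ϱ ^ 2 / ℏ ^ 2) *
            (∫ x, (Ψ x * v x t) ^ 2 * Real.exp (-‖x - x₀‖ ^ 2 / ℏ))
          + 4 * p₂ * (⨆ x, ‖gradient Ψ x‖) ^ 2 * Real.exp (-(ϱ - ε) ^ 2 / ℏ) *
              ∫ x, (v x t) ^ 2 := by
  intro t ht
  have htI := Set.Ioo_subset_Icc_self ht
  obtain ⟨hp0, hp2⟩ := hpbd t htI
  have hΨone : ContDiff ℝ 1 Ψ := hΨ.of_le (by exact_mod_cast le_top)
  have hvt : ContDiff ℝ 2 fun x => v x t :=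
    contDiff_infty.1 (hv.comp (contDiff_id.prodMk contDiff_const)) 2
  set w : EuclideanSpace ℝ (Fin n) → ℝ := fun x => Real.exp (-‖x - x₀‖ ^ 2 / ℏ) with hw
  have hwC : ContDiff ℝ 1 w := contDiff_gaussian x₀ ℏ
  have hθ : ContDiff ℝ 1 fun x => Ψ x ^ 2 * w x := (hΨone.pow 2).mul hwC
  have hθc : HasCompactSupport fun x => Ψ x ^ 2 * w x := by
    refine hΨc.mono' fun x hx => subset_tsupport _ fun h => hx ?_
    simp [h]
  have hE : (fun s => ∫ x, (Ψ x * v x s) ^ 2 * Real.exp (-‖x - x₀‖ ^ 2 / ℏ)) =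
      fun s => ∫ x, Ψ x ^ 2 * w x * v x s ^ 2 :=
    funext fun s => integral_congr_ae (.of_forall fun x => by simp only [hw]; ring)
  have hparts : ∫ x, Ψ x ^ 2 * w x * (2 * v x t * deriv (v x) t) =
      2 * p t * ∫ x, -∑ i, fderiv ℝ (fun y => Ψ y ^ 2 * w y * v y t) x
        (EuclideanSpace.single i 1) * fderiv ℝ (fun y => v y t) x (EuclideanSpace.single i 1) := by
    rw [← integral_mul_lapl (hθ.mul (hvt.of_le (by norm_num))) hθc.mul_right hvt,
      ← integral_const_mul]
    refine integral_congr_ae (.of_forall fun x => ?_)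
    simp only [hveq x t htI]
    ring
  have hbdd : BddAbove (Set.range fun x => ‖gradient Ψ x‖) := by
    obtain ⟨C, hC⟩ := (hΨc.fderiv ℝ).exists_bound_of_continuous
      (hΨone.continuous_fderiv one_ne_zero)
    refine ⟨C, ?_⟩
    rintro _ ⟨x, rfl⟩
    simpa [gradient] using hC x
  set M := ⨆ x, ‖gradient Ψ x‖
  have hgrad (x : EuclideanSpace ℝ (Fin n)) :
      ‖gradient Ψ x‖ ^ 2 * w x ≤ M ^ 2 * Real.exp (-(ϱ - ε) ^ 2 / ℏ) := by
    by_cases hx : x ∈ Metric.ball x₀ (ϱ - ε)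
    · have hloc : Ψ =ᶠ[nhds x] fun _ => 1 :=
        Filter.eventually_of_mem (Metric.isOpen_ball.mem_nhds hx) hΨ1
      have : gradient Ψ x = 0 := by simp [gradient, hloc.fderiv_eq]
      rw [this, norm_zero, zero_pow two_ne_zero, zero_mul]
      positivity
    · rw [Metric.mem_ball, dist_eq_norm, not_lt] at hx
      have := le_ciSup hbdd x
      have : 0 ≤ ϱ - ε := by linarith
      simp only [hw]
      gcongr
  have hsupp (x : EuclideanSpace ℝ (Fin n)) :
      ‖x - x₀‖ ^ 2 / ℏ ^ 2 * ((Ψ x * v x t) ^ 2 * w x) ≤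
        ϱ ^ 2 / ℏ ^ 2 * ((Ψ x * v x t) ^ 2 * w x) := by
    by_cases hx : x ∈ tsupport Ψ
    · have hxb : ‖x - x₀‖ ≤ ϱ := by simpa [dist_eq_norm] using (hΨsupp hx).le
      have : 0 ≤ w x := (Real.exp_pos _).le
      gcongr
    · simp [image_eq_zero_of_notMem_tsupport hx]
  have hint : Integrable fun x => (Ψ x * v x t) ^ 2 * w x := by
    have : Integrable fun x => Ψ x ^ 2 * w x * v x t ^ 2 :=
      (hθ.continuous.mul (hvt.continuous.pow 2)).integrable_of_hasCompactSupport hθc.mul_right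
    exact this.congr (.of_forall fun x => by ring)
  have hintv : Integrable fun x => v x t ^ 2 := by
    obtain ⟨V, hV⟩ := hvS t
    simpa only [hV] using (V.memLp 2).integrable_sq
  have hmono : ∫ x, -∑ i, fderiv ℝ (fun y => Ψ y ^ 2 * w y * v y t) x
        (EuclideanSpace.single i 1) * fderiv ℝ (fun y => v y t) x (EuclideanSpace.single i 1) ≤
      2 * (M ^ 2 * Real.exp (-(ϱ - ε) ^ 2 / ℏ) * ∫ x, v x t ^ 2) +
        2 * (ϱ ^ 2 / ℏ ^ 2 * ∫ x, (Ψ x * v x t) ^ 2 * w x) := by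
    simp_rw [← integral_const_mul]
    rw [← integral_add ((hintv.const_mul _).const_mul _) ((hint.const_mul _).const_mul _)]
    refine integral_mono ?_ (((hintv.const_mul _).const_mul _).add
      ((hint.const_mul _).const_mul _)) fun x => ?_
    · have hg : ContDiff ℝ 1 fun y => Ψ y ^ 2 * w y * v y t :=
        hθ.mul (hvt.of_le (by norm_num))
      refine (integrable_finsetSum _ fun i _ => ?_).neg
      exact (((hg.continuous_fderiv one_ne_zero).clm_apply continuous_const).mul
        ((hvt.continuous_fderiv two_ne_zero).clm_apply continuous_const))
        |>.integrable_of_hasCompactSupport (hθc.mul_right.fderiv_apply ℝ _).mul_right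
    · have h1 := neg_sum_fderiv_mul_fderiv_le (hΨone.differentiable one_ne_zero)
        (hvt.differentiable two_ne_zero) x₀ x ℏ
      have h2 := mul_le_mul_of_nonneg_right (hgrad x) (sq_nonneg (v x t))
      have h3 := hsupp x
      simp only [hw] at h1 h2 h3 ⊢
      linarith
  rw [hE, (hasDerivAt_integral_mul_sq hθ.continuous hθc
    (hv.of_le (by exact_mod_cast le_top)) t).deriv, hparts]
  have hI : 0 ≤ ∫ x, v x t ^ 2 := integral_nonneg fun x => sq_nonneg _
  have hJ : 0 ≤ ∫ x, (Ψ x * v x t) ^ 2 * w x :=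
    integral_nonneg fun x => mul_nonneg (sq_nonneg _) (Real.exp_pos _).le
  calc _ ≤ 2 * p t * (2 * (M ^ 2 * Real.exp (-(ϱ - ε) ^ 2 / ℏ) * ∫ x, v x t ^ 2) +
        2 * (ϱ ^ 2 / ℏ ^ 2 * ∫ x, (Ψ x * v x t) ^ 2 * w x)) := by gcongr
    _ ≤ 2 * p₂ * (2 * (M ^ 2 * Real.exp (-(ϱ - ε) ^ 2 / ℏ) * ∫ x, v x t ^ 2) +
        2 * (ϱ ^ 2 / ℏ ^ 2 * ∫ x, (Ψ x * v x t) ^ 2 * w x)) := by gcongr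
    _ = _ := by ring
end

section
/- Let P ≥ 0 and λ : ℕ → ℝ with λ i ≥ 0 for all i. Let a : ℕ → ℝ be square-summable with ‖a‖ > 0 and E² := Σᵢ λ i · (a i)² < ∞. Then ‖a‖ ≤ e^{P E² / ‖a‖²} · ( Σᵢ (a i)² e^{−2 λ i · P} )^{1/2}. -/
/-- Jensen's inequality for the exponential function, with unnormalised countable weights. -/
theorem tsum_mul_exp_div_le_tsum_mul_exp {ι : Type*} {w x : ι → ℝ} (hw : ∀ i, 0 ≤ w i)
    (hw_sum : Summable w) (hw_pos : 0 < ∑' i, w i) (hwx : Summable fun i => w i * x i)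
    (hexp : Summable fun i => w i * Real.exp (x i)) :
    (∑' i, w i) * Real.exp ((∑' i, w i * x i) / ∑' i, w i) ≤ ∑' i, w i * Real.exp (x i) := by
  set W := ∑' i, w i
  set m := (∑' i, w i * x i) / W with hm
  have tangent (i : ι) :
      Real.exp m * ((1 - m) * w i + w i * x i) ≤ w i * Real.exp (x i) := by
    have h := mul_le_mul_of_nonneg_left (Real.add_one_le_exp (x i - m)) (Real.exp_pos m).le
    rw [← Real.exp_add, add_sub_cancel] at h
    linarith [mul_le_mul_of_nonneg_left h (hw i)]
  have hsum : HasSum (fun i => Real.exp m * ((1 - m) * w i + w i * x i)) (W * Real.exp m) := by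
    have hmW : ∑' i, w i * x i = m * W := by rw [hm, div_mul_cancel₀ _ hw_pos.ne']
    have hvalue : W * Real.exp m = Real.exp m * ((1 - m) * W + ∑' i, w i * x i) := by
      rw [hmW]
      ring
    rw [hvalue]
    exact ((hw_sum.hasSum.mul_left (1 - m)).add hwx.hasSum).mul_left (Real.exp m)
  exact hasSum_le tangent hsum hexp.hasSum

/-- Spectral-coefficient form of the standard backward stability estimate
`‖a‖ ≤ e^{PE²/‖a‖²} (Σᵢ aᵢ² e^{−2λᵢP})^{1/2}`, proved by Jensen's inequality. -/
theorem backward_stability_estimate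
    (P : ℝ) (hP : 0 ≤ P) (lam a : ℕ → ℝ)
    (hlam : ∀ i, 0 ≤ lam i)
    (ha : Summable (fun i => (a i) ^ 2))
    (hapos : 0 < Real.sqrt (∑' i, (a i) ^ 2))
    (hE : Summable (fun i => lam i * (a i) ^ 2)) :
    Real.sqrt (∑' i, (a i) ^ 2) ≤
      Real.exp (P * (∑' i, lam i * (a i) ^ 2) / (∑' i, (a i) ^ 2)) *
        Real.sqrt (∑' i, (a i) ^ 2 * Real.exp (-2 * lam i * P)) := by
  have hA : 0 < ∑' i, (a i) ^ 2 := Real.sqrt_pos.mp hapos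
  have hexp : Summable fun i => (a i) ^ 2 * Real.exp (-2 * lam i * P) := by
    refine ha.of_nonneg_of_le (fun i => by positivity) fun i => ?_
    refine mul_le_of_le_one_right (sq_nonneg _) (Real.exp_le_one_iff.mpr ?_)
    linarith [mul_nonneg (hlam i) hP]
  have hmul : (fun i => (a i) ^ 2 * (-2 * lam i * P)) =
      fun i => -2 * P * (lam i * (a i) ^ 2) := by
    ext i
    ring
  have jensen := tsum_mul_exp_div_le_tsum_mul_exp (fun i => sq_nonneg (a i)) ha hA
    (hmul ▸ hE.mul_left (-2 * P)) hexp
  rw [hmul, tsum_mul_left] at jensen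
  set A := ∑' i, (a i) ^ 2
  set S := ∑' i, lam i * (a i) ^ 2
  have hA_eq : A = Real.exp (P * S / A) ^ 2 * (A * Real.exp (-2 * P * S / A)) := by
    rw [mul_left_comm, ← Real.exp_nat_mul, ← Real.exp_add]
    have : ((2 : ℕ) : ℝ) * (P * S / A) + -2 * P * S / A = 0 := by
      push_cast
      ring
    rw [this, Real.exp_zero, mul_one]
  rw [← Real.sqrt_sq (Real.exp_pos (P * S / A)).le, ← Real.sqrt_mul (sq_nonneg _)]
  refine Real.sqrt_le_sqrt ?_
  exact hA_eq.le.trans (mul_le_mul_of_nonneg_left jensen (sq_nonneg _))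
end

section
/- Let T > 0, p₂ > 0 and 0 < P ≤ p₂T. Let λ : ℕ → ℝ with λ i ≥ 0 for all i, and let a : ℕ → ℝ be square-summable with ‖a‖ > 0 and E² := Σᵢ λ i · (a i)² < ∞. Set b i := a i · e^{−λ i · P} and assume ‖b‖ < ‖a‖. Then ‖a‖ ≤ √(p₂T) · E / √( ln(‖a‖/‖b‖) ). -/
/-- Jensen's inequality for the exponential and a summable family of nonnegative weights. -/
theorem tsum_mul_exp_weighted_mean_le {ι : Type*} {w x : ι → ℝ} (hw : ∀ i, 0 ≤ w i)
    (hsum : Summable w) (hpos : 0 < ∑' i, w i) (hwx : Summable fun i => w i * x i)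
    (hexp : Summable fun i => w i * Real.exp (x i)) :
    (∑' i, w i) * Real.exp ((∑' i, w i * x i) / ∑' i, w i) ≤ ∑' i, w i * Real.exp (x i) := by
  set m := (∑' i, w i * x i) / ∑' i, w i with hm
  have hmean : ∑' i, w i * x i = m * ∑' i, w i := by
    rw [hm, div_mul_cancel₀ _ hpos.ne']
  have htangent : HasSum (fun i => Real.exp m * ((1 - m) * w i + w i * x i))
      (Real.exp m * ((1 - m) * (∑' i, w i) + ∑' i, w i * x i)) :=
    ((hsum.hasSum.mul_left (1 - m)).add hwx.hasSum).mul_left (Real.exp m)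
  have hle := hasSum_le (fun i => ?_) htangent hexp.hasSum
  · rw [hmean] at hle
    linarith
  · have h := Real.add_one_le_exp (x i - m)
    have hsplit : Real.exp (x i) = Real.exp m * Real.exp (x i - m) := by
      rw [← Real.exp_add, add_sub_cancel]
    calc Real.exp m * ((1 - m) * w i + w i * x i)
        = w i * (Real.exp m * (x i - m + 1)) := by ring
      _ ≤ w i * (Real.exp m * Real.exp (x i - m)) := by
          have := hw i
          gcongr
      _ = w i * Real.exp (x i) := by rw [← hsplit]


/-- Spectral-coefficient form of the logarithmic backward estimate
`‖a‖ ≤ √(p₂T) E / √(ln(‖a‖/‖b‖))` where `b i = a i e^{−λᵢP}` are the coefficients of the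
solution at time `T`. -/
theorem log_backward_estimate
    (T p₂ P : ℝ) (hT : 0 < T) (hp₂ : 0 < p₂) (hP : 0 < P) (hPT : P ≤ p₂ * T)
    (lam a : ℕ → ℝ) (hlam : ∀ i, 0 ≤ lam i)
    (ha : Summable (fun i => (a i) ^ 2))
    (hapos : 0 < Real.sqrt (∑' i, (a i) ^ 2))
    (hE : Summable (fun i => lam i * (a i) ^ 2))
    (b : ℕ → ℝ) (hb : ∀ i, b i = a i * Real.exp (-(lam i) * P))
    (hba : Real.sqrt (∑' i, (b i) ^ 2) < Real.sqrt (∑' i, (a i) ^ 2)) :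
    Real.sqrt (∑' i, (a i) ^ 2) ≤
      Real.sqrt (p₂ * T) * Real.sqrt (∑' i, lam i * (a i) ^ 2) /
        Real.sqrt (Real.log (Real.sqrt (∑' i, (a i) ^ 2) /
          Real.sqrt (∑' i, (b i) ^ 2))) := by
  have hA : 0 < ∑' i, (a i) ^ 2 := Real.sqrt_pos.mp hapos
  have hbsq : ∀ i, (b i) ^ 2 = (a i) ^ 2 * Real.exp (-(2 * P) * lam i) := fun i => by
    rw [hb, mul_pow, ← Real.exp_nat_mul]
    congr 2
    push_cast
    ring
  have hB : Summable fun i => (a i) ^ 2 * Real.exp (-(2 * P) * lam i) :=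
    ha.of_nonneg_of_le (fun i => by positivity) fun i =>
      mul_le_of_le_one_right (sq_nonneg _) <| Real.exp_le_one_iff.mpr <| by
        have := mul_nonneg hP.le (hlam i)
        linarith
  have hcomm : (fun i => (a i) ^ 2 * (-(2 * P) * lam i)) =
      fun i => -(2 * P) * (lam i * (a i) ^ 2) := by
    funext i
    ring
  have hjensen := tsum_mul_exp_weighted_mean_le (fun i => sq_nonneg (a i)) ha hA
    (hcomm ▸ hE.mul_left (-(2 * P))) hB
  rw [hcomm, tsum_mul_left, ← tsum_congr hbsq] at hjensen
  have hF : 0 ≤ ∑' i, lam i * (a i) ^ 2 :=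
    tsum_nonneg fun i => mul_nonneg (hlam i) (sq_nonneg _)
  set A := ∑' i, (a i) ^ 2
  set B := ∑' i, (b i) ^ 2
  set F := ∑' i, lam i * (a i) ^ 2
  have hBpos : 0 < B := lt_of_lt_of_le (by positivity) hjensen
  have hsqrtB : 0 < Real.sqrt B := Real.sqrt_pos.mpr hBpos
  have hlogpos : 0 < Real.log (Real.sqrt A / Real.sqrt B) :=
    Real.log_pos ((one_lt_div hsqrtB).mpr hba)
  have hlog : Real.log (Real.sqrt A / Real.sqrt B) ≤ P * F / A := by
    have h := Real.log_le_log (by positivity) hjensen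
    rw [Real.log_mul hA.ne' (Real.exp_pos _).ne', Real.log_exp] at h
    rw [Real.log_div hapos.ne' hsqrtB.ne', Real.log_sqrt hA.le, Real.log_sqrt hBpos.le]
    have hneg : -(2 * P) * F / A = -2 * (P * F / A) := by ring
    linarith
  rw [le_div_iff₀ (Real.sqrt_pos.mpr hlogpos), ← Real.sqrt_mul hA.le,
    ← Real.sqrt_mul (mul_pos hp₂ hT).le]
  refine Real.sqrt_le_sqrt ?_
  calc A * Real.log (Real.sqrt A / Real.sqrt B) ≤ P * F := by
        rw [mul_comm]
        exact (le_div_iff₀ hA).mp hlog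
    _ ≤ p₂ * T * F := by gcongr
end
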